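/- arXiv:1806.06381 — 5 statements merged into one kernel-verified Lean document; each statement's English description precedes it below -/
import Mathlib

section
/- Let θ₁, θ₂, θ₃ ∈ ℝ² be non-collinear, let θ₀ ∈ ℝ² satisfy ‖θⱼ − θ₀‖ ≥ ε > 0 for j = 1, 2, 3, let ν > 0 and τⱼ(θ) = ‖θⱼ − θ‖/ν. Then there exist δ > 0 and c > 0 such that for every θ ∈ ℝ² with ‖θ − θ₀‖ ≤ δ one has Σ_{j=1}^{3} |τⱼ(θ) − τⱼ(θ₀)| ≥ c‖θ − θ₀‖. -/
/-- Inner products with the edge vectors at one vertex of an affine basis control the norm. -/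
theorem AffineIndependent.exists_norm_le_of_abs_inner_vsub_le {ι E : Type*} [Fintype ι]
    [NormedAddCommGroup E] [InnerProductSpace ℝ E] [FiniteDimensional ℝ E] {p : ι → E}
    (hp : AffineIndependent ℝ p) (hcard : Fintype.card ι = Module.finrank ℝ E + 1) (i₀ : ι) :
    ∃ K > (0 : ℝ), ∀ (v : E) (r : ℝ), 0 ≤ r → (∀ i, |inner ℝ (p i - p i₀) v| ≤ r) →
      ‖v‖ ≤ K * r := by
  let L : E →ₗ[ℝ] (ι → ℝ) := LinearMap.pi fun i => (innerSL ℝ (p i - p i₀)).toLinearMap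
  have hker : LinearMap.ker L = ⊥ := by
    refine LinearMap.ker_eq_bot'.2 fun v hv => ?_
    have hspan : vectorSpan ℝ (Set.range p) ≤ (ℝ ∙ v)ᗮ := by
      rw [vectorSpan_range_eq_span_range_vsub_right ℝ p i₀, Submodule.span_le]
      rintro _ ⟨i, rfl⟩
      exact Submodule.mem_orthogonal_singleton_iff_inner_left.2 (congrFun hv i)
    rw [hp.vectorSpan_eq_top_of_card_eq_finrank_add_one hcard] at hspan
    exact inner_self_eq_zero.1
      (Submodule.mem_orthogonal_singleton_iff_inner_left.1 (hspan (Submodule.mem_top (x := v))))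
  obtain ⟨K, hK, hL⟩ := L.exists_antilipschitzWith hker
  refine ⟨K, by exact_mod_cast hK, fun v r hr h => ?_⟩
  have hv := hL.le_mul_dist v 0
  rw [map_zero, dist_zero_right, dist_zero_right] at hv
  exact hv.trans (mul_le_mul_of_nonneg_left ((pi_norm_le_iff_of_nonneg hr).2 h) K.coe_nonneg)

/-- Differences of squared distances to two points depend linearly on the displacement. -/
theorem two_mul_inner_sub_eq_dist_sq_sub {E : Type*} [NormedAddCommGroup E]
    [InnerProductSpace ℝ E] (a b x y : E) :
    2 * inner ℝ (a - b) (y - x) =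
      (‖b - y‖ ^ 2 - ‖b - x‖ ^ 2) - (‖a - y‖ ^ 2 - ‖a - x‖ ^ 2) := by
  simp only [norm_sub_sq_real, inner_sub_left, inner_sub_right]
  ring

theorem abs_norm_sub_sq_sub_le {E : Type*} [SeminormedAddCommGroup E] (a x y : E) :
    |‖a - y‖ ^ 2 - ‖a - x‖ ^ 2| ≤
      (2 * ‖a - x‖ + ‖y - x‖) * |‖a - y‖ - ‖a - x‖| := by
  have h : ‖a - y‖ ≤ ‖a - x‖ + ‖y - x‖ := by
    simpa [norm_sub_rev x y] using norm_sub_le_norm_sub_add_norm_sub a x y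
  rw [sq_sub_sq, abs_mul, abs_of_nonneg (by positivity : 0 ≤ ‖a - y‖ + ‖a - x‖)]
  exact mul_le_mul_of_nonneg_right (by linarith) (abs_nonneg _)

/-- For non-collinear sensors θ₁, θ₂, θ₃ and a source θ₀ at distance at least
ε > 0 from each sensor, there are δ > 0 and c > 0 such that
Σⱼ |τⱼ(θ) − τⱼ(θ₀)| ≥ c‖θ − θ₀‖ for all θ with ‖θ − θ₀‖ ≤ δ. -/
theorem sum_delay_diff_lower_bound_local
    (θ : Fin 3 → EuclideanSpace ℝ (Fin 2)) (hθ : AffineIndependent ℝ θ)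
    (θ0 : EuclideanSpace ℝ (Fin 2)) (ε : ℝ) (hε : 0 < ε)
    (hsep : ∀ j : Fin 3, ε ≤ ‖θ j - θ0‖)
    (ν : ℝ) (hν : 0 < ν)
    (τ : Fin 3 → EuclideanSpace ℝ (Fin 2) → ℝ)
    (hτ : ∀ (j : Fin 3) (ϑ : EuclideanSpace ℝ (Fin 2)), τ j ϑ = ‖θ j - ϑ‖ / ν) :
    ∃ δ > (0 : ℝ), ∃ c > (0 : ℝ), ∀ ϑ : EuclideanSpace ℝ (Fin 2), ‖ϑ - θ0‖ ≤ δ →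
      c * ‖ϑ - θ0‖ ≤ ∑ j : Fin 3, |τ j ϑ - τ j θ0| := by
  obtain ⟨K, hK, hbound⟩ := hθ.exists_norm_le_of_abs_inner_vsub_le (by simp) 0
  set M : ℝ := 2 * ∑ j, ‖θ j - θ0‖ + 1
  have hM : 0 < M := by positivity
  refine ⟨1, one_pos, (K * (M * ν))⁻¹, by positivity, fun ϑ hϑ => ?_⟩
  set S : ℝ := ∑ j, |τ j ϑ - τ j θ0|
  have hsq (j : Fin 3) : |‖θ j - ϑ‖ ^ 2 - ‖θ j - θ0‖ ^ 2| ≤ M * ν * S := by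
    have hdist : ‖θ j - θ0‖ ≤ ∑ i, ‖θ i - θ0‖ :=
      Finset.single_le_sum (f := fun i => ‖θ i - θ0‖) (fun _ _ => norm_nonneg _)
        (Finset.mem_univ j)
    have hτS : |τ j ϑ - τ j θ0| ≤ S :=
      Finset.single_le_sum (f := fun i => |τ i ϑ - τ i θ0|) (fun _ _ => abs_nonneg _)
        (Finset.mem_univ j)
    have hdelay : |‖θ j - ϑ‖ - ‖θ j - θ0‖| = ν * |τ j ϑ - τ j θ0| := by
      rw [hτ, hτ, ← sub_div, abs_div, abs_of_pos hν, mul_div_cancel₀ _ hν.ne']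
    calc _ ≤ _ := abs_norm_sub_sq_sub_le (θ j) θ0 ϑ
      _ ≤ M * (ν * S) := by
        rw [hdelay]
        gcongr
        linarith
      _ = M * ν * S := by ring
  have hS : 0 ≤ S := Finset.sum_nonneg fun _ _ => abs_nonneg _
  have hnorm : ‖ϑ - θ0‖ ≤ K * (M * ν * S) := by
    refine hbound _ _ (by positivity) fun j => ?_
    have hpol := two_mul_inner_sub_eq_dist_sq_sub (θ j) (θ 0) θ0 ϑ
    have hj := abs_le.1 (hsq j)
    have h0 := abs_le.1 (hsq 0)
    exact abs_le.2 ⟨by linarith, by linarith⟩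
  rw [inv_mul_le_iff₀ (by positivity)]
  linarith
end

section
/- Let λ : ℝ → ℝ satisfy λ(t) = 0 for t < 0, λ nonnegative, bounded and Lipschitz continuous on [0, ∞); let λ₀ > 0, ν > 0, T > 0, and let θ₁, θ₂, θ₃, θ₀ ∈ ℝ². Define τⱼ(θ) = ‖θⱼ − θ‖/ν and λ_{j,n}(θ, t) = nλ(t − τⱼ(θ))·1_{t ≥ τⱼ(θ)} + nλ₀. Then there exists C > 0 such that for every n ≥ 1, every R > 0 and all u, v ∈ ℝ² with ‖u‖ + ‖v‖ ≤ R: Σ_{j=1}^{3} ∫₀ᵀ ( √(λ_{j,n}(θ₀ + u/n, t)) − √(λ_{j,n}(θ₀ + v/n, t)) )² dt ≤ C(1 + R)‖u − v‖. -/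
open MeasureTheory

/-- The Lipschitz bound for the square root on `[c, ∞)`, squared. -/
theorem sq_sqrt_sub_sqrt_le {x y c : ℝ} (hc : 0 < c) (hx : c ≤ x) (hy : c ≤ y) :
    (Real.sqrt x - Real.sqrt y) ^ 2 ≤ (x - y) ^ 2 / c := by
  have hx0 := hc.le.trans hx
  have hy0 := hc.le.trans hy
  rw [le_div_iff₀ hc]
  have h1 : x - y = (√x - √y) * (√x + √y) := by
    nlinarith [Real.mul_self_sqrt hx0, Real.mul_self_sqrt hy0]
  rw [h1, mul_pow]
  refine mul_le_mul_of_nonneg_left ?_ (sq_nonneg _)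
  nlinarith [Real.mul_self_sqrt hx0, Real.sqrt_nonneg x, Real.sqrt_nonneg y]

/-- A signal that vanishes on the negatives and is bounded and Lipschitz on `[0, ∞)` differs from
its translate by a bounded amount between the two onsets and by a Lipschitz amount elsewhere. -/
theorem sq_sub_translate_le {f : ℝ → ℝ} {M : ℝ} {L : NNReal} (hneg : ∀ t < 0, f t = 0)
    (hnonneg : ∀ t, 0 ≤ f t) (hM : ∀ t, f t ≤ M) (hL : LipschitzOnWith L f (Set.Ici 0))
    {a b : ℝ} (hab : a ≤ b) (t : ℝ) :
    (f (t - a) - f (t - b)) ^ 2 ≤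
      (Set.Ico a b).indicator (fun _ => M ^ 2) t + M * (L * (b - a)) := by
  have hM0 : 0 ≤ M := (hnonneg 0).trans (hM 0)
  have hrest : 0 ≤ M * (L * (b - a)) :=
    mul_nonneg hM0 (mul_nonneg L.coe_nonneg (sub_nonneg.2 hab))
  have habs : |f (t - a) - f (t - b)| ≤ M :=
    abs_le.2 ⟨by linarith [hnonneg (t - a), hM (t - b)], by linarith [hnonneg (t - b), hM (t - a)]⟩
  rcases lt_or_ge t a with hta | hta
  · rw [hneg _ (by linarith), hneg _ (by linarith), Set.indicator_of_notMem (by simp [hta])]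
    simpa using hrest
  rcases lt_or_ge t b with htb | htb
  · rw [Set.indicator_of_mem (Set.mem_Ico.2 ⟨hta, htb⟩), ← sq_abs]
    have := pow_le_pow_left₀ (abs_nonneg _) habs 2
    linarith
  · rw [Set.indicator_of_notMem (by simp [htb]), zero_add, ← sq_abs, sq]
    refine mul_le_mul habs ?_ (abs_nonneg _) hM0
    have h := hL.dist_le_mul (t - a) (Set.mem_Ici.2 (by linarith)) (t - b)
      (Set.mem_Ici.2 (by linarith))
    rw [Real.dist_eq, Real.dist_eq, show t - a - (t - b) = b - a by ring,
      abs_of_nonneg (sub_nonneg.2 hab)] at h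
    exact h

/-- The Hellinger-type integral between two delayed Poisson intensities at scale `n` is at most a
constant times `n` times the difference of the delays. -/
theorem integral_sq_sqrt_sub_sqrt_translate_le {f : ℝ → ℝ} {M : ℝ} {L : NNReal}
    (hneg : ∀ t < 0, f t = 0) (hnonneg : ∀ t, 0 ≤ f t) (hM : ∀ t, f t ≤ M)
    (hL : LipschitzOnWith L f (Set.Ici 0)) {c T n : ℝ} (hc : 0 < c) (hT : 0 ≤ T) (hn : 0 < n)
    (a b : ℝ) :
    ∫ t in (0 : ℝ)..T, (√(n * f (t - a) + n * c) - √(n * f (t - b) + n * c)) ^ 2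
      ≤ n / c * ((M ^ 2 + T * M * L) * |a - b|) := by
  wlog hab : a ≤ b generalizing a b
  · have h := this b a (le_of_not_ge hab)
    rw [abs_sub_comm] at h
    refine le_trans (le_of_eq ?_) h
    exact intervalIntegral.integral_congr fun t _ => by ring
  let g : ℝ → ℝ := fun t =>
    n / c * ((Set.Ico a b).indicator (fun _ => M ^ 2) t + M * (L * (b - a)))
  have hpt : ∀ t, (√(n * f (t - a) + n * c) - √(n * f (t - b) + n * c)) ^ 2 ≤ g t := by
    intro t
    have hpos : 0 < n * c := mul_pos hn hc
    refine (sq_sqrt_sub_sqrt_le hpos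
      (le_add_of_nonneg_left (mul_nonneg hn.le (hnonneg _)))
      (le_add_of_nonneg_left (mul_nonneg hn.le (hnonneg _)))).trans ?_
    rw [show (n * f (t - a) + n * c - (n * f (t - b) + n * c)) ^ 2 / (n * c)
      = n / c * (f (t - a) - f (t - b)) ^ 2 by field_simp; ring]
    exact mul_le_mul_of_nonneg_left (sq_sub_translate_le hneg hnonneg hM hL hab t)
      (div_pos hn hc).le
  have hind : Integrable ((Set.Ico a b).indicator fun _ : ℝ => M ^ 2) :=
    (integrable_indicator_iff measurableSet_Ico).2 (integrableOn_const (by simp))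
  have hconst : IntegrableOn (fun _ : ℝ => M * (L * (b - a))) (Set.Ioc 0 T) :=
    integrableOn_const (by simp)
  rw [intervalIntegral.integral_of_le hT, abs_sub_comm, abs_of_nonneg (sub_nonneg.2 hab)]
  refine (integral_mono_of_nonneg (Filter.Eventually.of_forall fun t => sq_nonneg _)
    ((hind.integrableOn.add hconst).const_mul (n / c)) (Filter.Eventually.of_forall hpt)).trans ?_
  rw [integral_const_mul]
  refine mul_le_mul_of_nonneg_left ?_ (div_pos hn hc).le
  rw [integral_add' hind.integrableOn hconst]
  have h1 : ∫ t in Set.Ioc 0 T, (Set.Ico a b).indicator (fun _ => M ^ 2) t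
      ≤ M ^ 2 * (b - a) := by
    refine (setIntegral_le_integral hind (Filter.Eventually.of_forall fun t =>
      Set.indicator_nonneg (fun _ _ => sq_nonneg M) t)).trans (le_of_eq ?_)
    rw [integral_indicator measurableSet_Ico]
    simp [hab, mul_comm]
  have h2 : ∫ _ in Set.Ioc 0 T, M * (L * (b - a)) = T * (M * (L * (b - a))) := by
    simp [hT]
  rw [h2]
  linarith

/-- **Lemma 2 of the paper.** For the change-point intensities
λ_{j,n}(θ, t) = nλ(t − τⱼ(θ))·1_{t ≥ τⱼ(θ)} + nλ₀ with τⱼ(θ) = ‖θⱼ − θ‖/ν, the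
Hellinger-type integral between the parameter points θ₀ + u/n and θ₀ + v/n is bounded by
C(1 + R)‖u − v‖ whenever ‖u‖ + ‖v‖ ≤ R. -/
theorem hellinger_increment_bound
    (lam : ℝ → ℝ) (hneg : ∀ t < (0 : ℝ), lam t = 0)
    (hnonneg : ∀ t, 0 ≤ lam t)
    (hbdd : ∃ M : ℝ, ∀ t ≥ (0 : ℝ), lam t ≤ M)
    (hlip : ∃ L : NNReal, LipschitzOnWith L lam (Set.Ici 0))
    (lam0 : ℝ) (hlam0 : 0 < lam0) (ν : ℝ) (hν : 0 < ν) (T : ℝ) (hT : 0 < T)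
    (θ : Fin 3 → EuclideanSpace ℝ (Fin 2)) (θ0 : EuclideanSpace ℝ (Fin 2))
    (τ : Fin 3 → EuclideanSpace ℝ (Fin 2) → ℝ)
    (hτ : ∀ (j : Fin 3) (ϑ : EuclideanSpace ℝ (Fin 2)), τ j ϑ = ‖θ j - ϑ‖ / ν)
    (lamn : Fin 3 → ℕ → EuclideanSpace ℝ (Fin 2) → ℝ → ℝ)
    (hlamn : ∀ (j : Fin 3) (n : ℕ) (ϑ : EuclideanSpace ℝ (Fin 2)) (t : ℝ),
      lamn j n ϑ t = n * (if τ j ϑ ≤ t then lam (t - τ j ϑ) else 0) + n * lam0) :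
    ∃ C > (0 : ℝ), ∀ n : ℕ, 1 ≤ n → ∀ R > (0 : ℝ),
      ∀ u v : EuclideanSpace ℝ (Fin 2), ‖u‖ + ‖v‖ ≤ R →
        (∑ j : Fin 3, ∫ t in (0 : ℝ)..T,
            (Real.sqrt (lamn j n (θ0 + (n : ℝ)⁻¹ • u) t)
              - Real.sqrt (lamn j n (θ0 + (n : ℝ)⁻¹ • v) t)) ^ 2)
          ≤ C * (1 + R) * ‖u - v‖ := by
  obtain ⟨M, hM⟩ := hbdd
  obtain ⟨L, hL⟩ := hlip
  have hM0 : 0 ≤ M := (hnonneg 0).trans (hM 0 le_rfl)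
  have hM' : ∀ t, lam t ≤ M := fun t => by
    rcases lt_or_ge t 0 with ht | ht
    · rwa [hneg t ht]
    · exact hM t ht
  have hform : ∀ j n ϑ t, lamn j n ϑ t = n * lam (t - τ j ϑ) + n * lam0 := by
    intro j n ϑ t
    rw [hlamn]
    split_ifs with h
    · rfl
    · rw [hneg _ (by linarith)]
  set K : ℝ := 3 * ((M ^ 2 + T * M * L) / (lam0 * ν)) with hK
  have hK0 : 0 ≤ K := by positivity
  refine ⟨K + 1, by linarith, fun n hn R hR u v _ => ?_⟩
  have hn0 : (0 : ℝ) < n := by exact_mod_cast hn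
  have hdelay : ∀ j, |τ j (θ0 + (n : ℝ)⁻¹ • u) - τ j (θ0 + (n : ℝ)⁻¹ • v)|
      ≤ ‖u - v‖ / (n * ν) := by
    intro j
    rw [hτ, hτ, ← sub_div, abs_div, abs_of_pos hν, ← div_div]
    refine div_le_div_of_nonneg_right ?_ hν.le
    refine (abs_norm_sub_norm_le _ _).trans (le_of_eq ?_)
    rw [show θ j - (θ0 + (n : ℝ)⁻¹ • u) - (θ j - (θ0 + (n : ℝ)⁻¹ • v))
      = (n : ℝ)⁻¹ • (v - u) by rw [smul_sub]; abel, norm_smul, norm_sub_rev v u,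
      Real.norm_of_nonneg (inv_nonneg.2 hn0.le), div_eq_inv_mul]
  have hterm : ∀ j : Fin 3, ∫ t in (0 : ℝ)..T,
      (√(lamn j n (θ0 + (n : ℝ)⁻¹ • u) t) - √(lamn j n (θ0 + (n : ℝ)⁻¹ • v) t)) ^ 2
      ≤ (M ^ 2 + T * M * L) / (lam0 * ν) * ‖u - v‖ := by
    intro j
    simp only [hform]
    refine (integral_sq_sqrt_sub_sqrt_translate_le hneg hnonneg hM' hL hlam0 hT.le hn0 _ _).trans ?_
    calc (n : ℝ) / lam0 * ((M ^ 2 + T * M * L)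
          * |τ j (θ0 + (n : ℝ)⁻¹ • u) - τ j (θ0 + (n : ℝ)⁻¹ • v)|)
        ≤ (n : ℝ) / lam0 * ((M ^ 2 + T * M * L) * (‖u - v‖ / (n * ν))) := by
          gcongr
          exact hdelay j
      _ = (M ^ 2 + T * M * L) / (lam0 * ν) * ‖u - v‖ := by field_simp
  calc _ ≤ ∑ _j : Fin 3, (M ^ 2 + T * M * L) / (lam0 * ν) * ‖u - v‖ :=
        Finset.sum_le_sum fun j _ => hterm j
    _ = K * ‖u - v‖ := by
        rw [Finset.sum_const, Finset.card_univ, Fintype.card_fin, nsmul_eq_mul, hK]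
        push_cast
        ring
    _ ≤ (K + 1) * (1 + R) * ‖u - v‖ := by
        refine mul_le_mul_of_nonneg_right ?_ (norm_nonneg _)
        nlinarith [mul_nonneg hK0 hR.le]
end

section
/- Let λ : ℝ → ℝ satisfy λ(t) = 0 for t < 0 and be continuous on [0, T], and set k = inf_{t ∈ [0, T]} λ(t)². Then for all 0 ≤ τ ≤ τ′ ≤ T: ∫₀ᵀ ( λ(t − τ′)·1_{t ≥ τ′} − λ(t − τ)·1_{t ≥ τ} )² dt ≥ ∫_τ^{τ′} λ(t − τ)² dt ≥ k(τ′ − τ). -/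
open Set MeasureTheory

/-- A function continuous on `[0, T]` is, after translation by `a`, continuous on any interval
that the translation maps into `[0, T]`. -/
lemma ContinuousOn.comp_sub_const_Icc {f : ℝ → ℝ} {T a b c : ℝ}
    (hf : ContinuousOn f (Icc 0 T)) (hb : a ≤ b) (hc : c ≤ T + a) :
    ContinuousOn (fun t => f (t - a)) (Icc b c) :=
  hf.comp (by fun_prop) fun t ht => ⟨by linarith [ht.1], by linarith [ht.2]⟩

/-- The squared difference of two delayed copies of a signal continuous on `[0, T]` is integrable
on `[0, T]`. -/
lemma intervalIntegrable_sq_sub_delayed {f : ℝ → ℝ} {T a b : ℝ}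
    (hf : ContinuousOn f (Icc 0 T)) (ha : 0 ≤ a) (hab : a ≤ b) (hb : b ≤ T) :
    IntervalIntegrable
      (fun t => ((if b ≤ t then f (t - b) else 0) - (if a ≤ t then f (t - a) else 0)) ^ 2)
      volume 0 T := by
  have before : IntervalIntegrable (fun _ : ℝ => (0 : ℝ)) volume 0 a := by simp
  have between : IntervalIntegrable (fun t => f (t - a) ^ 2) volume a b :=
    ((hf.comp_sub_const_Icc le_rfl (by linarith)).pow 2).intervalIntegrable_of_Icc hab
  have after : IntervalIntegrable (fun t => (f (t - b) - f (t - a)) ^ 2) volume b T :=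
    (((hf.comp_sub_const_Icc le_rfl (by linarith)).sub
      (hf.comp_sub_const_Icc hab (by linarith))).pow 2).intervalIntegrable_of_Icc hb
  refine ((before.congr_uIoo ?_).trans (between.congr_uIoo ?_)).trans (after.congr_uIoo ?_)
  · intro t ht
    rw [uIoo_of_le ha] at ht
    simp [ht.2.not_ge, (ht.2.trans_le hab).not_ge]
  · intro t ht
    rw [uIoo_of_le hab] at ht
    simp [ht.2.not_ge, ht.1.le]
  · intro t ht
    rw [uIoo_of_le hb] at ht
    simp [ht.1.le, hab.trans ht.1.le]

/-- For a signal intensity λ vanishing on negatives and continuous on [0, T],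
with k = inf_{t ∈ [0,T]} λ(t)², and delays 0 ≤ τ ≤ τ′ ≤ T, the squared L²(0, T) distance
between the shifted signals is at least ∫_τ^{τ′} λ(t − τ)² dt, which in turn is at least
k(τ′ − τ). -/
theorem sq_L2_dist_of_shifted_signal_ge
    (lam : ℝ → ℝ) (T : ℝ) (hT : 0 < T)
    (hneg : ∀ t < (0 : ℝ), lam t = 0)
    (hcont : ContinuousOn lam (Set.Icc 0 T))
    (k : ℝ) (hk : k = sInf ((fun t => (lam t) ^ 2) '' Set.Icc 0 T))
    (τ τ' : ℝ) (h0τ : 0 ≤ τ) (hττ' : τ ≤ τ') (hτ'T : τ' ≤ T) :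
    (∫ t in τ..τ', (lam (t - τ)) ^ 2)
        ≤ (∫ t in (0 : ℝ)..T,
            ((if τ' ≤ t then lam (t - τ') else 0) - (if τ ≤ t then lam (t - τ) else 0)) ^ 2)
      ∧ k * (τ' - τ) ≤ ∫ t in τ..τ', (lam (t - τ)) ^ 2 := by
  constructor
  · calc
      _ = ∫ t in τ..τ', ((if τ' ≤ t then lam (t - τ') else 0)
            - (if τ ≤ t then lam (t - τ) else 0)) ^ 2 := by
        refine intervalIntegral.integral_congr_Ioo_of_le hττ' fun t ht => ?_
        simp [ht.2.not_ge, ht.1.le]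
      _ ≤ _ := intervalIntegral.integral_mono_interval h0τ hττ' hτ'T
        (Filter.Eventually.of_forall fun t => sq_nonneg _)
        (intervalIntegrable_sq_sub_delayed hcont h0τ hττ' hτ'T)
  · have hbdd : BddBelow ((fun t => lam t ^ 2) '' Icc 0 T) :=
      ⟨0, forall_mem_image.2 fun t _ => sq_nonneg _⟩
    calc
      _ = ∫ _ in τ..τ', k := by simp [mul_comm]
      _ ≤ _ := intervalIntegral.integral_mono_on hττ' intervalIntegrable_const
        (((hcont.comp_sub_const_Icc le_rfl (by linarith)).pow 2).intervalIntegrable_of_Icc hττ')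
        fun t ht => hk ▸ csInf_le hbdd
          (mem_image_of_mem _ ⟨by linarith [ht.1], by linarith [ht.2]⟩)
end

section
/- Let λ : ℝ → ℝ satisfy λ(t) = 0 for t < 0, be continuous on [0, T] with λ(t) > 0 for all t ∈ [0, T], and let λ₀ > 0. Then there exists γ > 0 such that for all τ, τ′ ∈ [0, T]: ∫₀ᵀ ( √(λ(t − τ)·1_{t ≥ τ} + λ₀) − √(λ(t − τ′)·1_{t ≥ τ′} + λ₀) )² dt ≥ γ|τ − τ′|. -/
/-- The Hellinger-type distance between two ordered delays, for a signal intensity that is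
continuous and bounded between positive constants on the whole line. -/
lemma hellinger_dist_ge_of_continuous_of_le {L : ℝ → ℝ} (hL : Continuous L) {m C c : ℝ}
    (hm : 0 < m) (hmL : ∀ t, m ≤ L t) (hLC : ∀ t, L t ≤ C) (hc : 0 < c)
    {T a b : ℝ} (ha : 0 ≤ a) (hab : a ≤ b) (hb : b ≤ T) :
    (Real.sqrt (m + c) - Real.sqrt c) ^ 2 * (b - a) ≤ ∫ t in (0 : ℝ)..T,
      (Real.sqrt ((if a ≤ t then L (t - a) else 0) + c)
        - Real.sqrt ((if b ≤ t then L (t - b) else 0) + c)) ^ 2 := by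
  set g : ℝ → ℝ → ℝ := fun a t => Real.sqrt ((if a ≤ t then L (t - a) else 0) + c) with hg
  change _ ≤ ∫ t in (0 : ℝ)..T, (g a t - g b t) ^ 2
  have hmeas : ∀ a, Measurable (g a) := fun a =>
    ((Measurable.ite measurableSet_Ici (hL.measurable.comp (measurable_id.sub_const a))
      measurable_const).add_const c).sqrt
  have hg0 : ∀ a t, 0 ≤ g a t := fun a t => Real.sqrt_nonneg _
  have hC : 0 ≤ C := hm.le.trans ((hmL 0).trans (hLC 0))
  have hgC : ∀ a t, g a t ^ 2 ≤ C + c := by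
    intro a t
    have h1 := hmL (t - a)
    have h2 := hLC (t - a)
    simp only [hg]
    split_ifs
    · rw [Real.sq_sqrt (by linarith)]; linarith
    · rw [Real.sq_sqrt (by linarith)]; linarith
  have hint : ∀ x y, IntervalIntegrable (fun t => (g a t - g b t) ^ 2) MeasureTheory.volume x y := by
    intro x y
    refine (intervalIntegrable_const (c := 2 * (C + c))).mono_fun
      (((hmeas a).sub (hmeas b)).pow_const 2).aestronglyMeasurable (Filter.Eventually.of_forall ?_)
    intro t
    beta_reduce
    rw [Real.norm_of_nonneg (sq_nonneg _), Real.norm_of_nonneg (by positivity)]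
    nlinarith [hgC a t, hgC b t, mul_nonneg (hg0 a t) (hg0 b t)]
  calc (Real.sqrt (m + c) - Real.sqrt c) ^ 2 * (b - a)
      = ∫ _ in a..b, (Real.sqrt (m + c) - Real.sqrt c) ^ 2 := by
        rw [intervalIntegral.integral_const, smul_eq_mul, mul_comm]
    _ ≤ ∫ t in a..b, (g a t - g b t) ^ 2 := by
        refine intervalIntegral.integral_mono_on_of_le_Ioo hab intervalIntegrable_const
          (hint a b) fun t ht => ?_
        have h1 : Real.sqrt c ≤ Real.sqrt (m + c) := Real.sqrt_le_sqrt (by linarith)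
        have h2 : Real.sqrt (m + c) ≤ Real.sqrt (L (t - a) + c) :=
          Real.sqrt_le_sqrt (by linarith [hmL (t - a)])
        simp only [hg, if_pos ht.1.le, if_neg (not_le.2 ht.2), zero_add]
        exact pow_le_pow_left₀ (by linarith) (by linarith) 2
    _ ≤ ∫ t in (0 : ℝ)..T, (g a t - g b t) ^ 2 :=
        intervalIntegral.integral_mono_interval ha hab hb
          (Filter.Eventually.of_forall fun t => sq_nonneg _) (hint 0 T)


/-- **key estimate of Lemma 3.** For a signal intensity λ vanishing on negatives,
continuous and strictly positive on [0, T], and noise intensity λ₀ > 0, the Hellinger-type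
distance between the intensities with delays τ, τ′ ∈ [0, T] is bounded below by γ|τ − τ′|
for some γ > 0. -/
theorem hellinger_dist_ge_of_delays
    (lam : ℝ → ℝ) (T : ℝ) (hT : 0 < T)
    (hneg : ∀ t < (0 : ℝ), lam t = 0)
    (hcont : ContinuousOn lam (Set.Icc 0 T))
    (hpos : ∀ t ∈ Set.Icc (0 : ℝ) T, 0 < lam t)
    (lam0 : ℝ) (hlam0 : 0 < lam0) :
    ∃ γ > (0 : ℝ), ∀ τ ∈ Set.Icc (0 : ℝ) T, ∀ τ' ∈ Set.Icc (0 : ℝ) T,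
      γ * |τ - τ'| ≤ ∫ t in (0 : ℝ)..T,
        (Real.sqrt ((if τ ≤ t then lam (t - τ) else 0) + lam0)
          - Real.sqrt ((if τ' ≤ t then lam (t - τ') else 0) + lam0)) ^ 2 := by
  have hne : (Set.Icc (0 : ℝ) T).Nonempty := Set.nonempty_Icc.2 hT.le
  obtain ⟨p, hp, hpmin⟩ := isCompact_Icc.exists_isMinOn hne hcont
  obtain ⟨q, -, hqmax⟩ := isCompact_Icc.exists_isMaxOn hne hcont
  have hm := hpos p hp
  set L : ℝ → ℝ := Set.IccExtend hT.le ((Set.Icc (0 : ℝ) T).domRestrict lam) with hLdef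
  have hL : Continuous L := hcont.domRestrict.Icc_extend'
  have hmL : ∀ t, lam p ≤ L t := fun t => hpmin (Set.projIcc 0 T hT.le t).2
  have hLC : ∀ t, L t ≤ lam q := fun t => hqmax (Set.projIcc 0 T hT.le t).2
  have hlamL : ∀ t ∈ Set.Icc (0 : ℝ) T, lam t = L t := fun t ht => by
    rw [hLdef, Set.IccExtend_of_mem _ _ ht, Set.domRestrict_apply]
  have hite : ∀ τ ∈ Set.Icc (0 : ℝ) T, ∀ t ∈ Set.Icc (0 : ℝ) T,
      (if τ ≤ t then lam (t - τ) else 0) = if τ ≤ t then L (t - τ) else 0 := by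
    intro τ hτ t ht
    split_ifs with h
    · exact hlamL _ ⟨by linarith, by linarith [hτ.1, ht.2]⟩
    · rfl
  refine ⟨(Real.sqrt (lam p + lam0) - Real.sqrt lam0) ^ 2, ?_, fun τ hτ τ' hτ' => ?_⟩
  · exact pow_pos (sub_pos.2 (Real.sqrt_lt_sqrt hlam0.le (by linarith))) 2
  · have hcongr : (∫ t in (0 : ℝ)..T,
        (Real.sqrt ((if τ ≤ t then lam (t - τ) else 0) + lam0)
          - Real.sqrt ((if τ' ≤ t then lam (t - τ') else 0) + lam0)) ^ 2)
        = ∫ t in (0 : ℝ)..T,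
        (Real.sqrt ((if τ ≤ t then L (t - τ) else 0) + lam0)
          - Real.sqrt ((if τ' ≤ t then L (t - τ') else 0) + lam0)) ^ 2 := by
      refine intervalIntegral.integral_congr fun t ht => ?_
      rw [Set.uIcc_of_le hT.le] at ht
      simp only [hite τ hτ t ht, hite τ' hτ' t ht]
    rw [hcongr]
    rcases le_total τ τ' with h | h
    · rw [abs_sub_comm, abs_of_nonneg (sub_nonneg.2 h)]
      exact hellinger_dist_ge_of_continuous_of_le hL hm hmL hLC hlam0 hτ.1 h hτ'.2
    · rw [abs_of_nonneg (sub_nonneg.2 h)]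
      simp only [sub_sq_comm (Real.sqrt ((if τ ≤ _ then L (_ - τ) else 0) + lam0))]
      exact hellinger_dist_ge_of_continuous_of_le hL hm hmL hLC hlam0 hτ'.1 h hτ.2
end

section
/- Let λ : ℝ → ℝ satisfy λ(t) = 0 for t < 0 and be continuous with λ(t) > 0 on [0, T]; let ν > 0, let θ₁, θ₂, θ₃ ∈ ℝ² be non-collinear, and let Θ̄ ⊂ ℝ² be a compact set such that 0 < τⱼ(θ) < T for every θ ∈ Θ̄ and j = 1, 2, 3, where τⱼ(θ) = ‖θⱼ − θ‖/ν. Let K ⊂ Θ̄ be compact and δ > 0. Then there exists g > 0 such that for all θ₀ ∈ K and all θ ∈ Θ̄ with ‖θ − θ₀‖ ≥ δ: Σ_{j=1}^{3} ∫₀ᵀ ( λ(t − τⱼ(θ))·1_{t ≥ τⱼ(θ)} − λ(t − τⱼ(θ₀))·1_{t ≥ τⱼ(θ₀)} )² dt ≥ g; i.e., g_K(δ) = inf_{θ₀ ∈ K} inf_{θ ∈ Θ̄: ‖θ − θ₀‖ ≥ δ} of this sum is strictly positive. -/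
open MeasureTheory in
/-- Two copies of a signal that is bounded below by `m` on `[0, T]`, with onsets `a ≤ b` in
`[0, T]`, have squared `L²` distance at least `m ^ 2 * (b - a)`. -/
theorem sq_mul_sub_le_integral_sq_sub_delayed {lam : ℝ → ℝ} {T m a b : ℝ}
    (hcont : ContinuousOn lam (Set.Icc 0 T)) (hm : 0 ≤ m)
    (hlam : ∀ t ∈ Set.Icc (0 : ℝ) T, m ≤ lam t) (ha : 0 ≤ a) (hab : a ≤ b) (hb : b ≤ T) :
    m ^ 2 * (b - a) ≤ ∫ t in (0 : ℝ)..T,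
      ((if a ≤ t then lam (t - a) else 0) - (if b ≤ t then lam (t - b) else 0)) ^ 2 := by
  have hT : 0 ≤ T := ha.trans (hab.trans hb)
  obtain ⟨M, hM⟩ := isCompact_Icc.exists_bound_of_continuousOn hcont
  have hM0 : 0 ≤ M := (norm_nonneg _).trans (hM 0 ⟨le_rfl, hT⟩)
  set F : ℝ → ℝ → ℝ := fun c t ↦ if c ≤ t then lam (t - c) else 0 with hF
  have hmeas : ∀ c, 0 ≤ c →
      AEStronglyMeasurable (F c) (volume.restrict (Set.Ioc 0 T)) := by
    intro c hc
    set e := Set.IccExtend hT ((Set.Icc 0 T).domRestrict lam) with he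
    have hec : Continuous e := (continuousOn_iff_continuous_domRestrict.1 hcont).Icc_extend'
    have h : Measurable fun t ↦ if c ≤ t then e (t - c) else 0 :=
      Measurable.ite measurableSet_Ici (hec.comp (continuous_sub_right c)).measurable
        measurable_const
    refine h.aestronglyMeasurable.congr ?_
    filter_upwards [ae_restrict_mem measurableSet_Ioc] with t ht
    by_cases hct : c ≤ t
    · have : t - c ∈ Set.Icc 0 T := ⟨by linarith, by linarith [ht.2]⟩
      simp [hF, hct, he, Set.IccExtend_of_mem, this]
    · simp [hF, hct]
  have hbound : ∀ c, 0 ≤ c → ∀ t ∈ Set.Ioc 0 T, |F c t| ≤ M := by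
    intro c hc t ht
    by_cases hct : c ≤ t
    · simpa [hF, hct] using hM (t - c) ⟨by linarith, by linarith [ht.2]⟩
    · simpa [hF, hct] using hM0
  have hint : IntegrableOn (fun t ↦ (F a t - F b t) ^ 2) (Set.Ioc 0 T) := by
    refine IntegrableOn.of_bound measure_Ioc_lt_top
      (((hmeas a ha).sub (hmeas b (ha.trans hab))).pow 2) ((M + M) ^ 2) ?_
    filter_upwards [ae_restrict_mem measurableSet_Ioc] with t ht
    rw [norm_pow]
    have := abs_sub (F a t) (F b t)
    exact pow_le_pow_left₀ (norm_nonneg _) (this.trans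
      (add_le_add (hbound a ha t ht) (hbound b (ha.trans hab) t ht))) 2
  have hsub : Set.Ioo a b ⊆ Set.Ioc 0 T :=
    fun t ht ↦ ⟨ha.trans_lt ht.1, ht.2.le.trans hb⟩
  rw [intervalIntegral.integral_of_le hT]
  calc m ^ 2 * (b - a) = ∫ _ in Set.Ioo a b, m ^ 2 := by
        simp [hab, mul_comm]
    _ ≤ ∫ t in Set.Ioo a b, (F a t - F b t) ^ 2 := by
        refine setIntegral_mono_on (integrableOn_const measure_Ioo_lt_top.ne)
          (hint.mono_set hsub) measurableSet_Ioo fun t ht ↦ ?_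
        have h := hlam (t - a) ⟨by linarith [ht.1], by linarith [ht.2]⟩
        simpa [hF, ht.1.le, ht.2.not_ge] using pow_le_pow_left₀ hm h 2
    _ ≤ ∫ t in Set.Ioc 0 T, (F a t - F b t) ^ 2 :=
        setIntegral_mono_set hint (Filter.Eventually.of_forall fun t ↦ sq_nonneg _)
          hsub.eventuallyLE

/-- A point of the plane is determined by its distances to three non-collinear points. -/
theorem AffineIndependent.eq_of_forall_norm_sub_eq {θ : Fin 3 → EuclideanSpace ℝ (Fin 2)}
    (hθ : AffineIndependent ℝ θ) {x y : EuclideanSpace ℝ (Fin 2)}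
    (h : ∀ j, ‖θ j - x‖ = ‖θ j - y‖) : x = y := by
  have hspan : affineSpan ℝ (Set.range θ) = ⊤ :=
    hθ.affineSpan_eq_top_iff_card_eq_finrank_add_one.2 (by simp)
  have hle : affineSpan ℝ (Set.range θ) ≤ AffineSubspace.perpBisector x y := by
    rw [affineSpan_le]
    rintro _ ⟨j, rfl⟩
    exact AffineSubspace.mem_perpBisector_iff_dist_eq.2 (by simpa [dist_eq_norm] using h j)
  have hx : x ∈ AffineSubspace.perpBisector x y :=
    hle (hspan ▸ AffineSubspace.mem_top ℝ _ x)
  simpa using AffineSubspace.mem_perpBisector_iff_dist_eq.1 hx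

/-- **identifiability infimum g_K(δ) > 0.** For non-collinear sensors and a
signal intensity λ vanishing on negatives, continuous and positive on [0, T], the infimum over
θ₀ ∈ K and θ ∈ Θ̄ with ‖θ − θ₀‖ ≥ δ of the squared L² distance between the observed signal
intensities is strictly positive. -/
theorem identifiability_infimum_pos
    (lam : ℝ → ℝ) (T : ℝ) (hT : 0 < T)
    (hneg : ∀ t < (0 : ℝ), lam t = 0)
    (hcont : ContinuousOn lam (Set.Icc 0 T))
    (hpos : ∀ t ∈ Set.Icc (0 : ℝ) T, 0 < lam t)
    (ν : ℝ) (hν : 0 < ν)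
    (θ : Fin 3 → EuclideanSpace ℝ (Fin 2)) (hθ : AffineIndependent ℝ θ)
    (τ : Fin 3 → EuclideanSpace ℝ (Fin 2) → ℝ)
    (hτ : ∀ (j : Fin 3) (ϑ : EuclideanSpace ℝ (Fin 2)), τ j ϑ = ‖θ j - ϑ‖ / ν)
    (Θbar : Set (EuclideanSpace ℝ (Fin 2))) (hΘbar : IsCompact Θbar)
    (hτΘ : ∀ ϑ ∈ Θbar, ∀ j : Fin 3, 0 < τ j ϑ ∧ τ j ϑ < T)
    (K : Set (EuclideanSpace ℝ (Fin 2))) (hK : IsCompact K) (hKΘ : K ⊆ Θbar)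
    (δ : ℝ) (hδ : 0 < δ) :
    ∃ g > (0 : ℝ), ∀ θ0 ∈ K, ∀ ϑ ∈ Θbar, δ ≤ ‖ϑ - θ0‖ →
      g ≤ ∑ j : Fin 3, ∫ t in (0 : ℝ)..T,
        ((if τ j ϑ ≤ t then lam (t - τ j ϑ) else 0)
          - (if τ j θ0 ≤ t then lam (t - τ j θ0) else 0)) ^ 2 := by
  obtain ⟨t₀, ht₀, hmin⟩ := isCompact_Icc.exists_isMinOn (Set.nonempty_Icc.2 hT.le) hcont
  set m := lam t₀
  have hm : 0 < m := hpos t₀ ht₀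
  have hlow : ∀ x ∈ Θbar, ∀ y ∈ Θbar, ∀ j, m ^ 2 * |τ j x - τ j y| ≤ ∫ t in (0 : ℝ)..T,
      ((if τ j x ≤ t then lam (t - τ j x) else 0)
        - (if τ j y ≤ t then lam (t - τ j y) else 0)) ^ 2 := by
    intro x hx y hy j
    rcases le_total (τ j x) (τ j y) with hxy | hxy
    · rw [abs_sub_comm, abs_of_nonneg (sub_nonneg.2 hxy)]
      exact sq_mul_sub_le_integral_sq_sub_delayed hcont hm.le (fun t ht ↦ hmin ht)
        (hτΘ x hx j).1.le hxy (hτΘ y hy j).2.le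
    · rw [abs_of_nonneg (sub_nonneg.2 hxy)]
      simp_rw [sub_sq_comm (if τ j x ≤ _ then lam (_ - τ j x) else 0)]
      exact sq_mul_sub_le_integral_sq_sub_delayed hcont hm.le (fun t ht ↦ hmin ht)
        (hτΘ y hy j).1.le hxy (hτΘ x hx j).2.le
  have hτc : ∀ j, Continuous (τ j) := fun j ↦ by
    rw [show τ j = fun ϑ ↦ ‖θ j - ϑ‖ / ν from funext (hτ j)]
    fun_prop
  set S := K ×ˢ Θbar ∩ {p | δ ≤ ‖p.2 - p.1‖}
  have hS : IsCompact S := (hK.prod hΘbar).inter_right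
    (isClosed_le continuous_const (by fun_prop))
  rcases S.eq_empty_or_nonempty with hSe | hSne
  · refine ⟨1, one_pos, fun θ0 h0 ϑ h1 hd ↦ ?_⟩
    exact absurd (show (θ0, ϑ) ∈ S from ⟨⟨h0, h1⟩, hd⟩) (by simp [hSe])
  obtain ⟨p, hp, hpmin⟩ := hS.exists_isMinOn (f := fun p ↦ ∑ j, |τ j p.2 - τ j p.1|) hSne
    (by fun_prop)
  refine ⟨m ^ 2 * ∑ j, |τ j p.2 - τ j p.1|, mul_pos (pow_pos hm 2) ?_,
    fun θ0 h0 ϑ h1 hd ↦ ?_⟩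
  · refine (Finset.sum_nonneg fun j _ ↦ abs_nonneg _).lt_of_ne' fun hzero ↦ ?_
    rw [Finset.sum_eq_zero_iff_of_nonneg fun j _ ↦ abs_nonneg _] at hzero
    have heq : p.2 = p.1 := hθ.eq_of_forall_norm_sub_eq fun j ↦ by
      have := sub_eq_zero.1 (abs_eq_zero.1 (hzero j (Finset.mem_univ j)))
      rwa [hτ, hτ, div_left_inj' hν.ne'] at this
    have hd : δ ≤ ‖p.2 - p.1‖ := hp.2
    rw [heq, sub_self, norm_zero] at hd
    exact hδ.not_ge hd
  · calc m ^ 2 * ∑ j, |τ j p.2 - τ j p.1| ≤ m ^ 2 * ∑ j, |τ j ϑ - τ j θ0| :=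
          mul_le_mul_of_nonneg_left
            (hpmin (show (θ0, ϑ) ∈ S from ⟨⟨h0, h1⟩, hd⟩)) (sq_nonneg m)
      _ ≤ _ := by
          rw [Finset.mul_sum]
          exact Finset.sum_le_sum fun j _ ↦ hlow ϑ h1 θ0 (hKΘ h0) j
end
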